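/- arXiv:0812.4673 — 3 statements merged into one kernel-verified Lean document; each statement's English description precedes it below -/
import Mathlib

section
/- Under the assumptions of the Edmond–Thibault theorem (C : I ⇉ H closed η-prox-regular valued, moving in an absolutely continuous way, f measurable in t, continuous in x, with linear growth controlled by β ∈ L¹ and locally Lipschitz in x with constants k_M ∈ L¹), for all t ∈ I and M > 0 there exists a constant a > 0 (depending on t and M) such that if u and v are the solutions of the sweeping process u̇ + N(C(t),u) ∋ f(t,u) associated with initial data u₀ and v₀ with ‖u₀‖ ≤ M and ‖v₀‖ ≤ M, then ‖u(t) − v(t)‖ ≤ a‖u₀ − v₀‖. -/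
open MeasureTheory Set Filter Topology

noncomputable section

/-- The (set-valued) metric projection onto `C`:
`P_C(y) = {z ∈ C | ‖y - z‖ = d(y,C)}`. -/
def projSet {E : Type*} [NormedAddCommGroup E] (C : Set E) (y : E) : Set E :=
  {z | z ∈ C ∧ ‖y - z‖ = Metric.infDist y C}

/-- The proximal normal cone of `C` at `x`:
`N(C,x) = {v | ∃ s > 0, x ∈ P_C(x + s v)}`. -/
def proxNormalCone {E : Type*} [NormedAddCommGroup E] [NormedSpace ℝ E]
    (C : Set E) (x : E) : Set E :=
  {v | ∃ s : ℝ, 0 < s ∧ x ∈ projSet C (x + s • v)}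

/-- `C` is `η`-prox-regular: for every `x ∈ C` and every nonzero proximal normal `v`,
the open ball `B(x + η v/‖v‖, η)` does not meet `C`. -/
def ProxRegular {E : Type*} [NormedAddCommGroup E] [NormedSpace ℝ E]
    (η : ℝ) (C : Set E) : Prop :=
  ∀ x ∈ C, ∀ v ∈ proxNormalCone C x, v ≠ 0 →
    Metric.ball (x + (η * ‖v‖⁻¹) • v) η ∩ C = ∅

/-- An absolutely continuous solution of the sweeping process
`u̇(t) + N(C(t),u(t)) ∋ f(t,u(t))`, `u(0) = u₀`, on `[0,T]`: `u` is absolutely continuous,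
i.e. `u(t) = u₀ + ∫₀ᵗ g` for some Bochner-integrable density `g` (`g = u̇` a.e.),
`u(t) ∈ C(t)` for all `t ∈ [0,T]` and `f(t,u(t)) - u̇(t) ∈ N(C(t),u(t))` a.e. on `[0,T]`. -/
def IsSweepingSol {E : Type*} [NormedAddCommGroup E] [NormedSpace ℝ E] [CompleteSpace E]
    (C : ℝ → Set E) (f : ℝ → E → E) (T : ℝ) (u₀ : E) (u : ℝ → E) : Prop :=
  ∃ g : ℝ → E, IntegrableOn g (Set.Icc 0 T) ∧
    (∀ t ∈ Set.Icc (0:ℝ) T, u t = u₀ + ∫ s in (0:ℝ)..t, g s) ∧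
    (∀ t ∈ Set.Icc (0:ℝ) T, u t ∈ C t) ∧
    (∀ᵐ t ∂volume.restrict (Set.Icc (0:ℝ) T),
      f t (u t) - g t ∈ proxNormalCone (C t) (u t))

/-- A function is absolutely continuous on `[a,b]` iff it is an indefinite integral of an
integrable function. -/
def IsAbsContOn (w : ℝ → ℝ) (a b : ℝ) : Prop :=
  ∃ g : ℝ → ℝ, IntegrableOn g (Set.Icc a b) ∧
    ∀ t ∈ Set.Icc a b, w t = w a + ∫ s in a..t, g s

/-- A function whose increments are dominated by those of an absolutely continuous function is
absolutely continuous. -/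
theorem AbsolutelyContinuousOnInterval.of_dist_le {X Y : Type*} [PseudoMetricSpace X]
    [PseudoMetricSpace Y] {φ : ℝ → X} {ψ : ℝ → Y} {a b L : ℝ}
    (hψ : AbsolutelyContinuousOnInterval ψ a b)
    (h : ∀ x ∈ uIcc a b, ∀ y ∈ uIcc a b, dist (φ x) (φ y) ≤ L * dist (ψ x) (ψ y)) :
    AbsolutelyContinuousOnInterval φ a b := by
  have hlim := Tendsto.const_mul L hψ
  rw [mul_zero] at hlim
  refine squeeze_zero' (Eventually.of_forall fun E => Finset.sum_nonneg fun i _ => dist_nonneg)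
    ?_ hlim
  filter_upwards [mem_inf_of_right (mem_principal_self _)] with E hE
  rw [Finset.mul_sum]
  exact Finset.sum_le_sum fun i hi => h _ (hE.1 i hi).1 _ (hE.1 i hi).2

theorem AbsolutelyContinuousOnInterval.norm_sq {E : Type*} [NormedAddCommGroup E]
    {u : ℝ → E} {a b : ℝ} (hu : AbsolutelyContinuousOnInterval u a b) :
    AbsolutelyContinuousOnInterval (fun t => ‖u t‖ ^ 2) a b := by
  obtain ⟨R, hR⟩ := hu.exists_bound
  refine hu.of_dist_le (L := 2 * R) fun x hx y hy => ?_
  have hab : |‖u x‖ - ‖u y‖| ≤ ‖u x - u y‖ := abs_norm_sub_norm_le _ _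
  rw [Real.dist_eq, dist_eq_norm, sq_sub_sq, abs_mul, abs_of_nonneg (by positivity)]
  have := hR x hx
  have := hR y hy
  exact mul_le_mul (by linarith) hab (abs_nonneg _) (by linarith [norm_nonneg (u x)])

theorem AbsolutelyContinuousOnInterval.exp_neg {K : ℝ → ℝ} {a b : ℝ}
    (hK : AbsolutelyContinuousOnInterval K a b) :
    AbsolutelyContinuousOnInterval (fun t => Real.exp (-K t)) a b := by
  obtain ⟨R, hR⟩ := hK.exists_bound
  refine hK.of_dist_le (L := Real.exp R) fun x hx y hy => ?_
  have hxR := neg_le_of_abs_le (hR x hx)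
  have hyR := neg_le_of_abs_le (hR y hy)
  have h := (convex_Iic R).norm_image_sub_le_of_norm_deriv_le (f := Real.exp) (C := Real.exp R)
    (x := -K y) (y := -K x) (fun z _ => Real.differentiableAt_exp)
    (fun z hz => by simpa using hz) (by simpa using (by linarith : -K y ≤ R))
    (by simpa using (by linarith : -K x ≤ R))
  rw [Real.dist_eq, Real.dist_eq]
  refine h.trans (le_of_eq ?_)
  rw [Real.norm_eq_abs, abs_sub_comm (K x)]
  congr 2
  ring

/-- **Grönwall's lemma** for an absolutely continuous function and an integrable rate. -/
theorem AbsolutelyContinuousOnInterval.le_mul_exp_of_deriv_le {φ κ : ℝ → ℝ} {a b : ℝ} (hab : a ≤ b)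
    (hφ : AbsolutelyContinuousOnInterval φ a b) (hκ : IntervalIntegrable κ volume a b)
    (h : ∀ᵐ t, t ∈ Icc a b → deriv φ t ≤ κ t * φ t) :
    φ b ≤ φ a * Real.exp (∫ s in a..b, κ s) := by
  set K : ℝ → ℝ := fun t => ∫ s in a..t, κ s with hKdef
  have hK : AbsolutelyContinuousOnInterval K a b :=
    hκ.absolutelyContinuousOnInterval_intervalIntegral left_mem_uIcc
  have hψ := hφ.fun_mul hK.exp_neg
  have hint := hψ.integral_deriv_eq_sub
  have hle : ∫ t in a..b, deriv (fun t => φ t * Real.exp (-K t)) t ≤ 0 := by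
    have : ∫ t in a..b, deriv (fun t => φ t * Real.exp (-K t)) t ≤ ∫ t in a..b, (0 : ℝ) := by
      refine intervalIntegral.integral_mono_ae_restrict hab hψ.intervalIntegrable_deriv
        (by simp) ?_
      rw [EventuallyLE, ae_restrict_iff' measurableSet_Icc]
      filter_upwards [h, hφ.ae_differentiableAt, hκ.ae_hasDerivAt_integral] with t h1 h2 h3 ht
      have ht' : t ∈ uIcc a b := by rwa [uIcc_of_le hab]
      have hd := (h2 ht').hasDerivAt.mul (h3 ht' a left_mem_uIcc).neg.exp
      have hd' : deriv (fun t => φ t * Real.exp (-K t)) t = _ := hd.deriv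
      rw [hd']
      have := mul_le_mul_of_nonneg_right (h1 ht) (Real.exp_pos (-K t)).le
      simp only [hKdef] at this
      simp only [Pi.neg_apply]
      linarith
    simpa using this
  rw [hint] at hle
  have hKa : K a = 0 := by simp [hKdef]
  simp only [hKa, neg_zero, Real.exp_zero, mul_one, sub_nonpos] at hle
  calc φ b = φ b * Real.exp (-K b) * Real.exp (K b) := by
        rw [mul_assoc, ← Real.exp_add]; simp
    _ ≤ _ := mul_le_mul_of_nonneg_right hle (Real.exp_pos _).le

theorem absolutelyContinuousOnInterval_integral {E : Type*} [NormedAddCommGroup E]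
    [NormedSpace ℝ E] {g : ℝ → E} {a b : ℝ} (hg : IntervalIntegrable g volume a b) :
    AbsolutelyContinuousOnInterval (fun t => ∫ s in a..t, g s) a b := by
  refine (hg.norm.absolutelyContinuousOnInterval_intervalIntegral
    (left_mem_uIcc (b := b))).of_dist_le (L := 1) fun x hx y hy => ?_
  have hmono : ∀ z ∈ uIcc a b, IntervalIntegrable g volume a z := fun z hz =>
    hg.mono_set (uIcc_subset_uIcc left_mem_uIcc hz)
  rw [dist_eq_norm, Real.dist_eq, one_mul,
    intervalIntegral.integral_interval_sub_left (hmono x hx) (hmono y hy),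
    intervalIntegral.integral_interval_sub_left (hmono x hx).norm (hmono y hy).norm]
  exact intervalIntegral.norm_integral_le_abs_integral_norm

section InnerProduct

variable {H : Type*} [NormedAddCommGroup H] [InnerProductSpace ℝ H]

theorem norm_smul_inv_norm_eq {η : ℝ} (hη : 0 < η) {v : H} (hv : v ≠ 0) :
    ‖(η * ‖v‖⁻¹) • v‖ = η := by
  rw [norm_smul, Real.norm_of_nonneg (by positivity), mul_assoc,
    inv_mul_cancel₀ (norm_ne_zero_iff.mpr hv), mul_one]

theorem ProxRegular.le_norm_sub {η : ℝ} {C : Set H} (hC : ProxRegular η C) {x y v : H}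
    (hx : x ∈ C) (hv : v ∈ proxNormalCone C x) (hv0 : v ≠ 0) (hy : y ∈ C) :
    η ≤ ‖x + (η * ‖v‖⁻¹) • v - y‖ := by
  by_contra! h
  have : y ∈ Metric.ball (x + (η * ‖v‖⁻¹) • v) η ∩ C :=
    ⟨by rwa [Metric.mem_ball, dist_comm, dist_eq_norm], hy⟩
  rw [hC x hx v hv hv0] at this
  exact this

/-- Hypomonotonicity of the proximal normal cone of a prox-regular set. -/
theorem ProxRegular.inner_le {η : ℝ} (hη : 0 < η) {C : Set H} (hC : ProxRegular η C) {x y v : H}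
    (hx : x ∈ C) (hv : v ∈ proxNormalCone C x) (hy : y ∈ C) :
    2 * inner ℝ v (y - x) ≤ ‖v‖ / η * ‖y - x‖ ^ 2 := by
  rcases eq_or_ne v 0 with rfl | hv0
  · simp
  have h1 := hC.le_norm_sub hx hv hv0 hy
  have h2 : η ^ 2 ≤ ‖(η * ‖v‖⁻¹) • v - (y - x)‖ ^ 2 := by
    have : (η * ‖v‖⁻¹) • v - (y - x) = x + (η * ‖v‖⁻¹) • v - y := by abel
    rw [this]
    gcongr
  rw [norm_sub_sq_real, norm_smul_inv_norm_eq hη hv0, real_inner_smul_left] at h2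
  have hvpos : 0 < ‖v‖ := norm_pos_iff.mpr hv0
  have h3 : 2 * ((η * ‖v‖⁻¹) * inner ℝ v (y - x)) ≤ ‖y - x‖ ^ 2 := by linarith
  have h4 := mul_le_mul_of_nonneg_left h3 (by positivity : 0 ≤ ‖v‖ / η)
  calc 2 * inner ℝ v (y - x) = ‖v‖ / η * (2 * ((η * ‖v‖⁻¹) * inner ℝ v (y - x))) := by
        field_simp
    _ ≤ _ := h4

/-- At a time of differentiability, the normal component of the velocity of a curve staying in a
moving prox-regular set is controlled by the speed of the set. -/
theorem norm_normal_le {η : ℝ} (hη : 0 < η) {C : ℝ → Set H} {w : ℝ → ℝ} {S : Set ℝ} {t : ℝ}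
    (hS : S ∈ 𝓝 t) (hC : ProxRegular η (C t))
    (hCvar : ∀ y : H, ∀ s ∈ S,
      |Metric.infDist y (C t) - Metric.infDist y (C s)| ≤ |w t - w s|)
    {u : ℝ → H} (hu : ∀ s ∈ S, u s ∈ C s) {F u' : H} {w' : ℝ}
    (hu' : HasDerivAt u u' t) (hw' : HasDerivAt w w' t)
    (hv : F - u' ∈ proxNormalCone (C t) (u t)) :
    ‖F - u'‖ ≤ ‖F‖ + |w'| := by
  set v := F - u' with hvdef
  rcases eq_or_ne v 0 with h0 | h0
  · rw [h0, norm_zero]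
    positivity
  have htS : t ∈ S := mem_of_mem_nhds hS
  have hvpos : 0 < ‖v‖ := norm_pos_iff.mpr h0
  set p := (η * ‖v‖⁻¹) • v with hp
  have hpn : ‖p‖ = η := norm_smul_inv_norm_eq hη h0
  have hlow : ∀ s ∈ S, η ≤ ‖u t + p - u s‖ + |w s - w t| := by
    intro s hs
    have h1 : η ≤ Metric.infDist (u t + p) (C t) := by
      refine (Metric.le_infDist ⟨u t, hu t htS⟩).mpr fun y hy => ?_
      rw [dist_eq_norm]
      exact hC.le_norm_sub (hu t htS) hv h0 hy
    have h2 : Metric.infDist (u t + p) (C t) ≤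
        Metric.infDist (u s) (C t) + dist (u t + p) (u s) := Metric.infDist_le_infDist_add_dist
    have h3 := hCvar (u s) s hs
    rw [Metric.infDist_zero_of_mem (hu s hs), sub_zero, abs_of_nonneg Metric.infDist_nonneg,
      abs_sub_comm] at h3
    rw [dist_eq_norm] at h2
    linarith
  have hq : HasDerivAt (fun s => ‖u t + p - u s‖ ^ 2) (2 * inner ℝ p (-u')) t := by
    have := (hu'.const_sub (u t + p)).norm_sq
    simpa using this
  have hIio : Iio t ⊆ {t}ᶜ := fun s hs => ne_of_lt (mem_Iio.mp hs)
  have hlim1 := (hasDerivAt_iff_tendsto_slope.mp hq).mono_left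
    (nhdsWithin_mono t hIio)
  have hlim2 := (((hasDerivAt_iff_tendsto_slope.mp hw').mono_left
    (nhdsWithin_mono t hIio)).abs).const_mul (2 * η)
  have hcmp := le_of_tendsto_of_tendsto hlim1 hlim2 (by
    filter_upwards [self_mem_nhdsWithin, mem_nhdsWithin_of_mem_nhds hS] with s hst hs
    have hpos : 0 < t - s := sub_pos.mpr (mem_Iio.mp hst)
    rw [slope_def_field, slope_def_field, abs_div, abs_of_neg (by linarith : s - t < 0),
      neg_sub, ← neg_sub t s, div_neg, ← neg_div, ← mul_div_assoc]
    apply (div_le_div_iff_of_pos_right hpos).mpr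
    have h1 := hlow s hs
    have h2 : ‖u t + p - u t‖ = η := by rw [add_sub_cancel_left, hpn]
    rw [h2]
    have h3 := norm_nonneg (u t + p - u s)
    have h4 := mul_nonneg hη.le (abs_nonneg (w s - w t))
    rcases le_total η ‖u t + p - u s‖ with h5 | h5 <;> nlinarith)
  have h1 : -inner ℝ v u' ≤ ‖v‖ * |w'| := by
    rw [inner_neg_right, hp, real_inner_smul_left] at hcmp
    have h4 := mul_le_mul_of_nonneg_left hcmp (by positivity : 0 ≤ ‖v‖ / (2 * η))
    calc -inner ℝ v u' = ‖v‖ / (2 * η) * (2 * -(η * ‖v‖⁻¹ * inner ℝ v u')) := by field_simp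
      _ ≤ _ := h4
      _ = _ := by field_simp
  have h2 : inner ℝ v F ≤ ‖v‖ * ‖F‖ := real_inner_le_norm v F
  have h3 : ‖v‖ * ‖v‖ = inner ℝ v F - inner ℝ v u' := by
    rw [← real_inner_self_eq_norm_mul_norm, ← inner_sub_right]
  exact le_of_mul_le_mul_left (by linarith) hvpos

variable [CompleteSpace H]

theorem IsAbsContOn.exists_ae_hasDerivAt {w : ℝ → ℝ} {T : ℝ} (hT : 0 ≤ T)
    (hw : IsAbsContOn w 0 T) :
    ∃ w' : ℝ → ℝ, IntervalIntegrable w' volume 0 T ∧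
      ∀ᵐ t, t ∈ Icc (0 : ℝ) T → HasDerivAt w (w' t) t := by
  obtain ⟨g, hg, h⟩ := hw
  have hgi : IntervalIntegrable g volume 0 T :=
    (intervalIntegrable_iff_integrableOn_Icc_of_le hT).mpr hg
  refine ⟨g, hgi, ?_⟩
  filter_upwards [hgi.ae_hasDerivAt_integral, Measure.ae_ne volume 0, Measure.ae_ne volume T]
    with t ht h0 h1 htI
  have hI : Icc (0 : ℝ) T ∈ 𝓝 t := Icc_mem_nhds (lt_of_le_of_ne htI.1 (Ne.symm h0))
    (lt_of_le_of_ne htI.2 h1)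
  refine ((ht (by rwa [uIcc_of_le hT]) 0 left_mem_uIcc).const_add (w 0)).congr_of_eventuallyEq ?_
  filter_upwards [hI] with s hs using h s hs

theorem IsSweepingSol.exists_ae_velocity {η : ℝ} (hη : 0 < η) {T : ℝ} (hT : 0 ≤ T)
    {C : ℝ → Set H} (hCprox : ∀ t ∈ Icc (0 : ℝ) T, ProxRegular η (C t)) {w w' : ℝ → ℝ}
    (hw' : ∀ᵐ t, t ∈ Icc (0 : ℝ) T → HasDerivAt w (w' t) t)
    (hCvar : ∀ y : H, ∀ s ∈ Icc (0 : ℝ) T, ∀ t ∈ Icc (0 : ℝ) T,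
      |Metric.infDist y (C t) - Metric.infDist y (C s)| ≤ |w t - w s|)
    {f : ℝ → H → H} {u₀ : H} {u : ℝ → H} (hu : IsSweepingSol C f T u₀ u) :
    AbsolutelyContinuousOnInterval u 0 T ∧ u 0 = u₀ ∧ (∀ t ∈ Icc (0 : ℝ) T, u t ∈ C t) ∧
      ∃ g : ℝ → H, ∀ᵐ t, t ∈ Icc (0 : ℝ) T → HasDerivAt u (g t) t ∧
        f t (u t) - g t ∈ proxNormalCone (C t) (u t) ∧
        ‖f t (u t) - g t‖ ≤ ‖f t (u t)‖ + |w' t| := by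
  obtain ⟨g, hg, h, hmem, hN⟩ := hu
  have hgi : IntervalIntegrable g volume 0 T :=
    (intervalIntegrable_iff_integrableOn_Icc_of_le hT).mpr hg
  refine ⟨?_, by simpa using h 0 ⟨le_rfl, hT⟩, hmem, g, ?_⟩
  · refine (absolutelyContinuousOnInterval_integral hgi).of_dist_le (L := 1) fun x hx y hy => ?_
    rw [uIcc_of_le hT] at hx hy
    rw [h x hx, h y hy, dist_add_left, one_mul]
  · rw [ae_restrict_iff' measurableSet_Icc] at hN
    filter_upwards [hgi.ae_hasDerivAt_integral, Measure.ae_ne volume 0, Measure.ae_ne volume T,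
      hw', hN] with t ht h0 h1 hwt hNt htI
    have hI : Icc (0 : ℝ) T ∈ 𝓝 t := Icc_mem_nhds (lt_of_le_of_ne htI.1 (Ne.symm h0))
      (lt_of_le_of_ne htI.2 h1)
    have hd : HasDerivAt u (g t) t := by
      refine ((ht (by rwa [uIcc_of_le hT]) 0 left_mem_uIcc).const_add u₀).congr_of_eventuallyEq ?_
      filter_upwards [hI] with s hs using h s hs
    exact ⟨hd, hNt htI, norm_normal_le hη hI (hCprox t htI)
      (fun y s hs => hCvar y s hs t htI) hmem hd (hwt htI) (hNt htI)⟩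

end InnerProduct

/-- **Stability of solutions of the sweeping process.** Under the assumptions of the
Edmond–Thibault theorem, for all `t ∈ I` and `M > 0` there is a constant `a > 0`
(depending on `t` and `M`) such that the solutions `u`, `v` associated to initial data
`u₀`, `v₀` of norm at most `M` satisfy `‖u(t) - v(t)‖ ≤ a ‖u₀ - v₀‖`. -/
theorem sweeping_process_stability
    {H : Type*} [NormedAddCommGroup H] [InnerProductSpace ℝ H] [CompleteSpace H]
    (η : ℝ) (hη : 0 < η) (T : ℝ) (hT : 0 < T)
    (C : ℝ → Set H)
    (hCclosed : ∀ t ∈ Set.Icc (0:ℝ) T, IsClosed (C t))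
    (hCne : ∀ t ∈ Set.Icc (0:ℝ) T, (C t).Nonempty)
    (hCprox : ∀ t ∈ Set.Icc (0:ℝ) T, ProxRegular η (C t))
    (w : ℝ → ℝ) (hw : IsAbsContOn w 0 T)
    (hCvar : ∀ y : H, ∀ s ∈ Set.Icc (0:ℝ) T, ∀ t ∈ Set.Icc (0:ℝ) T,
      |Metric.infDist y (C t) - Metric.infDist y (C s)| ≤ |w t - w s|)
    (f : ℝ → H → H)
    (hfmeas : ∀ x : H, StronglyMeasurable fun t => f t x)
    (hfcont : ∀ t ∈ Set.Icc (0:ℝ) T, Continuous (f t))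
    (β : ℝ → ℝ) (hβpos : ∀ t, 0 ≤ β t) (hβint : IntegrableOn β (Set.Icc 0 T))
    (hgrowth : ∀ t ∈ Set.Icc (0:ℝ) T, ∀ x ∈ ⋃ s ∈ Set.Icc (0:ℝ) T, C s,
      ‖f t x‖ ≤ β t * (1 + ‖x‖))
    (hLip : ∀ M : ℝ, 0 < M → ∃ k : ℝ → ℝ, (∀ t, 0 ≤ k t) ∧ IntegrableOn k (Set.Icc 0 T) ∧
      ∀ t ∈ Set.Icc (0:ℝ) T, ∀ x ∈ Metric.ball (0:H) M, ∀ y ∈ Metric.ball (0:H) M,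
        ‖f t x - f t y‖ ≤ k t * ‖x - y‖) :
    ∀ t ∈ Set.Icc (0:ℝ) T, ∀ M : ℝ, 0 < M →
      ∃ a : ℝ, 0 < a ∧
        ∀ (u₀ v₀ : H), ‖u₀‖ ≤ M → ‖v₀‖ ≤ M → u₀ ∈ C 0 → v₀ ∈ C 0 →
          ∀ u v : ℝ → H, IsSweepingSol C f T u₀ u → IsSweepingSol C f T v₀ v →
            ‖u t - v t‖ ≤ a * ‖u₀ - v₀‖ := by
  intro t ht M hM
  obtain ⟨w', hw'i, hw'⟩ := hw.exists_ae_hasDerivAt hT.le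
  have hβi : IntervalIntegrable β volume 0 T :=
    (intervalIntegrable_iff_integrableOn_Icc_of_le hT.le).mpr hβint
  have hfb : ∀ u : ℝ → H, (∀ s ∈ Icc (0 : ℝ) T, u s ∈ C s) →
      ∀ s ∈ Icc (0 : ℝ) T, ‖f s (u s)‖ ≤ β s * (1 + ‖u s‖) := fun u hu s hs =>
    hgrowth s hs (u s) (mem_biUnion hs (hu s hs))
  have hsub : ∀ s ∈ Icc (0 : ℝ) T, uIcc 0 s ⊆ uIcc 0 T := fun s hs =>
    uIcc_subset_uIcc left_mem_uIcc (by rwa [uIcc_of_le hT.le])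
  obtain ⟨R, hRpos, hR⟩ : ∃ R : ℝ, 0 < R ∧ ∀ u₀ : H, ‖u₀‖ ≤ M → ∀ u : ℝ → H,
      IsSweepingSol C f T u₀ u → ∀ s ∈ Icc (0 : ℝ) T, ‖u s‖ ≤ R := by
    set κ : ℝ → ℝ := fun s => 6 * β s + |w' s| with hκdef
    have hκ : IntervalIntegrable κ volume 0 T := (hβi.const_mul 6).add hw'i.abs
    have hκ0 : ∀ s, 0 ≤ κ s := fun s => by
      have := hβpos s
      positivity
    set R2 := (1 + M ^ 2) * Real.exp (∫ s in (0 : ℝ)..T, κ s) with hR2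
    have hR2pos : 0 < R2 := by positivity
    refine ⟨Real.sqrt R2, Real.sqrt_pos.mpr hR2pos, fun u₀ hu₀ u hu s hs => ?_⟩
    obtain ⟨hac, hu0, hmem, g, hg⟩ := hu.exists_ae_velocity hη hT.le hCprox hw' hCvar
    have hφ : AbsolutelyContinuousOnInterval (fun r => 1 + ‖u r‖ ^ 2) 0 s :=
      (hac.norm_sq.of_dist_le (L := 1) (fun x _ y _ => by simp)).mono (hsub s hs)
    have hgr := hφ.le_mul_exp_of_deriv_le hs.1 (hκ.mono_set (hsub s hs)) (by
      filter_upwards [hg] with r hr hrs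
      have hrT : r ∈ Icc (0 : ℝ) T := ⟨hrs.1, hrs.2.trans hs.2⟩
      obtain ⟨hd, -, hb⟩ := hr hrT
      rw [(hd.norm_sq.const_add 1).deriv]
      have hf1 := hfb u hmem r hrT
      have hgn : ‖g r‖ ≤ ‖f r (u r)‖ + ‖f r (u r) - g r‖ := by
        have := norm_sub_le (f r (u r)) (f r (u r) - g r)
        rwa [sub_sub_cancel] at this
      have hin : inner ℝ (u r) (g r) ≤ ‖u r‖ * ‖g r‖ := real_inner_le_norm _ _
      have hgn2 : ‖g r‖ ≤ 2 * (β r * (1 + ‖u r‖)) + |w' r| := by linarith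
      have hmul := mul_le_mul_of_nonneg_left hgn2 (norm_nonneg (u r))
      have hβr := hβpos r
      have hwr := abs_nonneg (w' r)
      simp only [hκdef]
      nlinarith [mul_nonneg hβr (sq_nonneg (‖u r‖ - 1)), mul_nonneg hwr (sq_nonneg (‖u r‖ - 1)),
        mul_nonneg hβr (sq_nonneg ‖u r‖)])
    have hmonoK : ∫ r in (0 : ℝ)..s, κ r ≤ ∫ r in (0 : ℝ)..T, κ r :=
      intervalIntegral.integral_mono_interval le_rfl hs.1 hs.2
        (Eventually.of_forall hκ0) hκ
    apply Real.le_sqrt_of_sq_le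
    have h0 : 1 + ‖u 0‖ ^ 2 ≤ 1 + M ^ 2 := by
      rw [hu0]
      gcongr
    have : (1 + ‖u 0‖ ^ 2) * Real.exp (∫ r in (0 : ℝ)..s, κ r) ≤ R2 := by
      rw [hR2]
      gcongr
    linarith
  obtain ⟨k, hk0, hkint, hk⟩ := hLip (R + 1) (by linarith)
  have hki : IntervalIntegrable k volume 0 T :=
    (intervalIntegrable_iff_integrableOn_Icc_of_le hT.le).mpr hkint
  set κ : ℝ → ℝ := fun s => 2 * k s + 2 / η * (β s * (1 + R) + |w' s|) with hκdef
  have hκ : IntervalIntegrable κ volume 0 T :=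
    (hki.const_mul 2).add (((hβi.mul_const (1 + R)).add hw'i.abs).const_mul (2 / η))
  refine ⟨Real.sqrt (Real.exp (∫ s in (0 : ℝ)..t, κ s)), Real.sqrt_pos.mpr (Real.exp_pos _), ?_⟩
  intro u₀ v₀ hu₀ hv₀ _ _ u v hu hv
  have hRu := hR u₀ hu₀ u hu
  have hRv := hR v₀ hv₀ v hv
  obtain ⟨hacu, hu0, hmemu, g, hg⟩ := hu.exists_ae_velocity hη hT.le hCprox hw' hCvar
  obtain ⟨hacv, hv0, hmemv, l, hl⟩ := hv.exists_ae_velocity hη hT.le hCprox hw' hCvar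
  have hφ : AbsolutelyContinuousOnInterval (fun r => ‖u r - v r‖ ^ 2) 0 t :=
    (hacu.fun_sub hacv).norm_sq.mono (hsub t ht)
  have hgr := hφ.le_mul_exp_of_deriv_le ht.1 (hκ.mono_set (hsub t ht)) (by
    filter_upwards [hg, hl] with r hgr hlr hrt
    have hrT : r ∈ Icc (0 : ℝ) T := ⟨hrt.1, hrt.2.trans ht.2⟩
    obtain ⟨hdu, hNu, hbu⟩ := hgr hrT
    obtain ⟨hdv, hNv, hbv⟩ := hlr hrT
    rw [(hdu.fun_sub hdv).norm_sq.deriv]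
    have hbound : ∀ z : ℝ → H, (∀ s ∈ Icc (0 : ℝ) T, z s ∈ C s) → ‖z r‖ ≤ R →
        ‖f r (z r)‖ ≤ β r * (1 + R) := fun z hz hzR =>
      (hfb z hz r hrT).trans (mul_le_mul_of_nonneg_left (by linarith) (hβpos r))
    have hfu := hbound u hmemu (hRu r hrT)
    have hfv := hbound v hmemv (hRv r hrT)
    have hlip := hk r hrT (u r) (by rw [mem_ball_zero_iff]; linarith [hRu r hrT])
      (v r) (by rw [mem_ball_zero_iff]; linarith [hRv r hrT])
    have hiu := (hCprox r hrT).inner_le hη (hmemu r hrT) hNu (hmemv r hrT)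
    have hiv := (hCprox r hrT).inner_le hη (hmemv r hrT) hNv (hmemu r hrT)
    rw [norm_sub_rev (v r)] at hiu
    have hif : inner ℝ (u r - v r) (f r (u r) - f r (v r)) ≤ k r * ‖u r - v r‖ ^ 2 := by
      refine (real_inner_le_norm _ _).trans ?_
      have := mul_le_mul_of_nonneg_left hlip (norm_nonneg (u r - v r))
      linarith
    have hsplit : inner ℝ (u r - v r) (g r - l r) =
        inner ℝ (u r - v r) (f r (u r) - f r (v r)) + inner ℝ (f r (u r) - g r) (v r - u r)
          + inner ℝ (f r (v r) - l r) (u r - v r) := by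
      rw [← neg_sub (u r) (v r), inner_neg_right, real_inner_comm (u r - v r) (f r (u r) - g r),
        real_inner_comm (u r - v r) (f r (v r) - l r), ← sub_eq_add_neg, ← inner_sub_right,
        ← inner_add_right]
      congr 1
      abel
    have hcoef : ∀ x : H, ‖x‖ ≤ β r * (1 + R) + |w' r| →
        ‖x‖ / η * ‖u r - v r‖ ^ 2 ≤ (β r * (1 + R) + |w' r|) / η * ‖u r - v r‖ ^ 2 :=
      fun x hx => by gcongr
    have hcu := hcoef (f r (u r) - g r) (by linarith)
    have hcv := hcoef (f r (v r) - l r) (by linarith)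
    have hκr : κ r * ‖u r - v r‖ ^ 2 = 2 * (k r * ‖u r - v r‖ ^ 2) +
        2 * ((β r * (1 + R) + |w' r|) / η * ‖u r - v r‖ ^ 2) := by
      simp only [hκdef]
      ring
    rw [hκr, hsplit]
    linarith)
  rw [hu0, hv0] at hgr
  refine le_of_sq_le_sq ?_ (by positivity)
  rw [mul_pow, Real.sq_sqrt (Real.exp_pos _).le]
  linarith
end
end

section
/- The crowd-motion feasible set Q := {q ∈ ℝ^{2N} : D_ij(q) ≥ 0 for all i ≠ j} ⊂ ℝ^{2N}, where D_ij(q) = |q_i − q_j| − 2r (the model without obstacles), is η-prox-regular for some constant η = η(N,r) > 0. -/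
open MeasureTheory Set Filter Topology

noncomputable section

/-- The configuration space `ℝ^{2N}` of `N` disks in the plane, with its Euclidean
(Hilbert) structure. -/
abbrev Conf (N : ℕ) := PiLp 2 fun _ : Fin N => EuclideanSpace ℝ (Fin 2)

/-- `D_{ij}(q) = |q_i - q_j| - 2r`, the signed distance between disks `i` and `j`. -/
def Dij {N : ℕ} (r : ℝ) (q : Conf N) (i j : Fin N) : ℝ := ‖q i - q j‖ - 2 * r

/-- The set of feasible configurations `Q = {q | D_{ij}(q) ≥ 0 ∀ i ≠ j}`. -/
def Qset (N : ℕ) (r : ℝ) : Set (Conf N) :=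
  {q | ∀ i j : Fin N, i ≠ j → 0 ≤ Dij r q i j}

/-- A proximal normal makes a nonacute angle with every feasible direction. -/
theorem inner_nonpos_of_mem_proxNormalCone {E : Type*} [NormedAddCommGroup E]
    [InnerProductSpace ℝ E] {C : Set E} {x v w : E} (hv : v ∈ proxNormalCone C x)
    (hw : ∀ᶠ t : ℝ in 𝓝[>] 0, x + t • w ∈ C) : inner ℝ v w ≤ 0 := by
  obtain ⟨s, hs, -, hdist⟩ := hv
  have hlim : Tendsto (fun t : ℝ => t * ‖w‖ ^ 2) (𝓝[>] 0) (𝓝 0) := by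
    have : Tendsto (fun t : ℝ => t * ‖w‖ ^ 2) (𝓝 0) (𝓝 (0 * ‖w‖ ^ 2)) :=
      (continuous_id.mul continuous_const).tendsto 0
    rw [zero_mul] at this
    exact this.mono_left nhdsWithin_le_nhds
  have hle : 2 * s * inner ℝ v w ≤ 0 := by
    refine ge_of_tendsto hlim ?_
    filter_upwards [hw, self_mem_nhdsWithin] with t ht htpos
    have htpos : 0 < t := htpos
    have h1 := Metric.infDist_le_dist_of_mem (x := x + s • v) ht
    rw [← hdist, dist_eq_norm, add_sub_cancel_left, add_sub_add_left_eq_sub] at h1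
    have h2 := pow_le_pow_left₀ (norm_nonneg _) h1 2
    rw [norm_sub_sq_real, real_inner_smul_left, real_inner_smul_right, norm_smul t w, mul_pow,
      Real.norm_eq_abs, sq_abs] at h2
    refine le_of_mul_le_mul_left ?_ htpos
    nlinarith
  nlinarith

/-- A quadratic upper bound on `⟪v, z - x⟫` over `C` for all proximal normals gives
prox-regularity. -/
theorem proxRegular_of_inner_le {E : Type*} [NormedAddCommGroup E] [InnerProductSpace ℝ E]
    {C : Set E} {η : ℝ} (hη : 0 < η)
    (h : ∀ x ∈ C, ∀ v ∈ proxNormalCone C x, ∀ z ∈ C,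
      2 * η * inner ℝ v (z - x) ≤ ‖v‖ * ‖z - x‖ ^ 2) : ProxRegular η C := by
  intro x hx v hv hv0
  rw [Set.eq_empty_iff_forall_notMem]
  rintro z ⟨hz, hzC⟩
  have hvpos : 0 < ‖v‖ := norm_pos_iff.2 hv0
  rw [Metric.mem_ball, dist_eq_norm, ← sub_sub] at hz
  have h1 := pow_lt_pow_left₀ hz (norm_nonneg _) two_ne_zero
  rw [norm_sub_sq_real, real_inner_smul_right, norm_smul, Real.norm_of_nonneg (by positivity),
    inv_mul_cancel_right₀ hvpos.ne', mul_assoc η, real_inner_comm] at h1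
  have h2 := mul_le_mul_of_nonneg_left (h x hx v hv z hzC) (inv_nonneg.2 hvpos.le)
  rw [inv_mul_cancel_left₀ hvpos.ne'] at h2
  linarith

/-- The contact graph of a configuration: two distinct disks are adjacent when they touch. -/
def contactGraph {N : ℕ} (r : ℝ) (q : Conf N) : SimpleGraph (Fin N) where
  Adj i j := i ≠ j ∧ ‖q i - q j‖ = 2 * r
  symm := ⟨fun i j h => ⟨h.1.symm, by rw [norm_sub_rev]; exact h.2⟩⟩
  loopless := ⟨fun _ h => h.1 rfl⟩

theorem norm_sub_le_of_contact_walk {N : ℕ} {r : ℝ} {q : Conf N} {i j : Fin N}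
    (p : (contactGraph r q).Walk i j) : ‖q i - q j‖ ≤ 2 * r * p.length := by
  induction p with
  | nil => simp
  | @cons a b c hab p ih =>
    have h := norm_sub_le_norm_sub_add_norm_sub (q a) (q b) (q c)
    rw [hab.2] at h
    rw [SimpleGraph.Walk.length_cons]
    push_cast
    linarith

/-- The displacement that dilates every cluster of touching disks about one of its members:
it separates all touching disks at a uniform rate and has bounded norm. -/
theorem exists_cluster_dilation {N : ℕ} {r : ℝ} (hr : 0 < r) (q : Conf N) :
    ∃ d : Conf N, ‖d‖ ≤ 2 * r * (N ^ 2 + 1) ∧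
      ∀ i j, i ≠ j → ‖q i - q j‖ = 2 * r → d i - d j = q i - q j := by
  let G := contactGraph r q
  let c : Fin N → Fin N := fun i => (G.connectedComponentMk i).out
  refine ⟨WithLp.toLp 2 fun i => q i - q (c i), ?_, ?_⟩
  · have hd : ∀ i, ‖q i - q (c i)‖ ≤ 2 * r * N := by
      intro i
      have hreach : G.Reachable i (c i) :=
        (SimpleGraph.ConnectedComponent.exact (Quot.out_eq (G.connectedComponentMk i))).symm
      obtain ⟨p, hp⟩ := hreach.exists_isPath
      have hlen : p.length < N := by simpa using hp.length_lt
      refine (norm_sub_le_of_contact_walk p).trans ?_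
      gcongr
    refine le_of_sq_le_sq ?_ (by positivity)
    rw [PiLp.norm_sq_eq_of_L2]
    calc ∑ i, ‖q i - q (c i)‖ ^ 2 ≤ ∑ _i : Fin N, (2 * r * (N : ℝ)) ^ 2 :=
          Finset.sum_le_sum fun i _ => pow_le_pow_left₀ (norm_nonneg _) (hd i) 2
      _ = (2 * r) ^ 2 * (N : ℝ) ^ 3 := by
          rw [Finset.sum_const, Finset.card_univ, Fintype.card_fin, nsmul_eq_mul]
          ring
      _ ≤ (2 * r) ^ 2 * ((N : ℝ) ^ 2 + 1) ^ 2 := by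
          gcongr
          nlinarith [sq_nonneg ((N : ℝ) * (N - 1)), sq_nonneg (N : ℝ)]
      _ = (2 * r * ((N : ℝ) ^ 2 + 1)) ^ 2 := by ring
  · intro i j hij hq
    have hadj : G.Adj i j := ⟨hij, hq⟩
    have hc : c i = c j := by
      simp only [c, SimpleGraph.ConnectedComponent.sound hadj.reachable]
    simp [hc]

theorem norm_apply_sub_sq_le {N : ℕ} (h : Conf N) {i j : Fin N} (hij : i ≠ j) :
    ‖h i - h j‖ ^ 2 ≤ 2 * ‖h‖ ^ 2 := by
  have h1 : ‖h i‖ ^ 2 + ‖h j‖ ^ 2 ≤ ‖h‖ ^ 2 := by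
    rw [PiLp.norm_sq_eq_of_L2 _ h, ← Finset.sum_pair (f := fun k => ‖h k‖ ^ 2) hij]
    exact Finset.sum_le_sum_of_subset_of_nonneg (Finset.subset_univ _) fun _ _ _ => sq_nonneg _
  have h2 := parallelogram_law_with_norm ℝ (h i) (h j)
  nlinarith [sq_nonneg ‖h i + h j‖]

/-- A direction that does not bring touching disks together to first order is feasible. -/
theorem eventually_add_smul_mem_Qset {N : ℕ} {r : ℝ} {q w : Conf N}
    (hq : q ∈ Qset N r)
    (hw : ∀ i j, i ≠ j → ‖q i - q j‖ = 2 * r → 0 ≤ inner ℝ (q i - q j) (w i - w j)) :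
    ∀ᶠ t : ℝ in 𝓝[>] 0, q + t • w ∈ Qset N r := by
  simp only [Qset, Set.mem_ofPred_eq, Filter.eventually_all, Dij]
  intro i j hij
  have hsplit : ∀ t : ℝ, (q + t • w) i - (q + t • w) j = (q i - q j) + t • (w i - w j) := by
    intro t
    simp only [PiLp.add_apply, PiLp.smul_apply, smul_sub]
    abel
  simp only [hsplit]
  have hqij : 2 * r ≤ ‖q i - q j‖ := sub_nonneg.1 (hq i j hij)
  rcases hqij.eq_or_lt with heq | hlt
  · filter_upwards [self_mem_nhdsWithin] with t ht
    have ht : 0 < t := ht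
    refine sub_nonneg.2 (le_of_sq_le_sq ?_ (norm_nonneg _))
    rw [norm_add_sq_real, real_inner_smul_right, heq]
    have := mul_nonneg ht.le (hw i j hij heq.symm)
    nlinarith [sq_nonneg ‖t • (w i - w j)‖]
  · have hcont : Continuous fun t : ℝ => ‖(q i - q j) + t • (w i - w j)‖ := by fun_prop
    have hev := (hcont.tendsto 0).eventually (lt_mem_nhds (a := 2 * r) (by simpa using hlt))
    filter_upwards [hev.filter_mono nhdsWithin_le_nhds] with t ht
    exact (sub_pos.2 ht).le

/-- The crowd-motion feasible set `Q ⊂ ℝ^{2N}` (model without obstacles) is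
`η`-prox-regular for some constant `η = η(N,r) > 0`. -/
theorem crowd_motion_feasible_set_prox_regular (N : ℕ) (r : ℝ) (hr : 0 < r) :
    ∃ η : ℝ, 0 < η ∧ ProxRegular η (Qset N r) := by
  have hK : (0 : ℝ) < (N : ℝ) ^ 2 + 1 := by positivity
  refine ⟨r / (N ^ 2 + 1), by positivity, proxRegular_of_inner_le (by positivity) ?_⟩
  intro x hx v hv z hz
  obtain ⟨d, hd, hdx⟩ := exists_cluster_dilation hr x
  set h := z - x with hh
  have hw : inner ℝ v (h + (‖h‖ ^ 2 / (4 * r ^ 2)) • d) ≤ 0 := by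
    refine inner_nonpos_of_mem_proxNormalCone hv (eventually_add_smul_mem_Qset hx ?_)
    intro i j hij hx2
    have hz2 : z i - z j = (x i - x j) + (h i - h j) := by
      simp only [hh, PiLp.sub_apply]
      abel
    have h1 := pow_le_pow_left₀ (by positivity) (sub_nonneg.1 (hz i j hij)) 2
    rw [hz2, norm_add_sq_real, hx2] at h1
    have h2 := norm_apply_sub_sq_le h hij
    have hsplit : (h + (‖h‖ ^ 2 / (4 * r ^ 2)) • d) i - (h + (‖h‖ ^ 2 / (4 * r ^ 2)) • d) j =
        (h i - h j) + (‖h‖ ^ 2 / (4 * r ^ 2)) • (x i - x j) := by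
      rw [← hdx i j hij hx2]
      simp only [PiLp.add_apply, PiLp.smul_apply, smul_sub]
      abel
    rw [hsplit, inner_add_right, real_inner_smul_right, real_inner_self_eq_norm_sq, hx2]
    have h3 : ‖h‖ ^ 2 / (4 * r ^ 2) * (2 * r) ^ 2 = ‖h‖ ^ 2 := by
      field_simp
      ring
    rw [h3]
    linarith
  rw [inner_add_right, real_inner_smul_right] at hw
  have hvd : -inner ℝ v d ≤ ‖v‖ * (2 * r * ((N : ℝ) ^ 2 + 1)) :=
    (neg_le_abs _).trans ((abs_real_inner_le_norm v d).trans
      (mul_le_mul_of_nonneg_left hd (norm_nonneg _)))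
  have hcoef : 0 ≤ ‖h‖ ^ 2 / (4 * r ^ 2) := by positivity
  have hvh : inner ℝ v h ≤ ‖h‖ ^ 2 / (4 * r ^ 2) * (‖v‖ * (2 * r * ((N : ℝ) ^ 2 + 1))) := by
    nlinarith [mul_le_mul_of_nonneg_left hvd hcoef]
  calc 2 * (r / ((N : ℝ) ^ 2 + 1)) * inner ℝ v h
      ≤ 2 * (r / ((N : ℝ) ^ 2 + 1)) *
          (‖h‖ ^ 2 / (4 * r ^ 2) * (‖v‖ * (2 * r * ((N : ℝ) ^ 2 + 1)))) :=
        mul_le_mul_of_nonneg_left hvh (by positivity)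
    _ = ‖v‖ * ‖h‖ ^ 2 := by
        field_simp
        ring
end
end

section
/- Let E be a uniformly smooth Banach space and p ∈ [2,∞). Then the duality-type mapping J_p is locally uniformly continuous: for all ε > 0 there exists δ > 0 such that for all x, y ∈ E with ‖x‖_E ≤ 1, ‖y‖_E ≤ 1 and ‖x − y‖_E ≤ δ, one has ‖J_p(x) − J_p(y)‖_{E*} ≤ ε. -/
open MeasureTheory Set Filter Topology

noncomputable section

/-- A uniformly smooth normed space: the norm is uniformly Fréchet differentiable away
from `0`, expressed through the vanishing of the modulus of smoothness. -/
def UniformlySmooth (E : Type*) [NormedAddCommGroup E] [NormedSpace ℝ E] : Prop :=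
  ∀ ε > (0:ℝ), ∃ δ > (0:ℝ), ∀ x y : E, ‖x‖ = 1 → ‖y‖ ≤ δ →
    ‖x + y‖ + ‖x - y‖ - 2 ≤ ε * ‖y‖

/-- The normalized duality-type mapping `J_p(x) = (1/p) (∇‖·‖^p)(x) ∈ E*`. -/
def dualMapJ {E : Type*} [NormedAddCommGroup E] [NormedSpace ℝ E]
    (p : ℝ) (x : E) : E →L[ℝ] ℝ :=
  p⁻¹ • fderiv ℝ (fun z : E => ‖z‖ ^ p) x

/-- In a uniformly smooth space the norm is approximated from above, uniformly in the base point
and to first order, by any of its supporting functionals. -/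
theorem UniformlySmooth.exists_norm_add_le {E : Type*} [NormedAddCommGroup E] [NormedSpace ℝ E]
    (hE : UniformlySmooth E) {ε : ℝ} (hε : 0 < ε) :
    ∃ δ > (0 : ℝ), ∀ (x h : E) (g : E →L[ℝ] ℝ), ‖g‖ ≤ 1 → g x = ‖x‖ → ‖h‖ ≤ δ * ‖x‖ →
      ‖x + h‖ ≤ ‖x‖ + g h + ε * ‖h‖ := by
  obtain ⟨δ, hδ, H⟩ := hE ε hε
  refine ⟨δ, hδ, fun x h g hg hgx hh => ?_⟩
  rcases eq_or_ne x 0 with rfl | hx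
  · have h0 : h = 0 := by simpa using hh
    simp [h0]
  have hx' : 0 < ‖x‖ := norm_pos_iff.2 hx
  have hscale : ∀ z : E, ‖‖x‖⁻¹ • z‖ = ‖x‖⁻¹ * ‖z‖ := fun z => by
    rw [norm_smul, norm_inv, norm_norm]
  have key := H (‖x‖⁻¹ • x) (‖x‖⁻¹ • h) (by rw [hscale, inv_mul_cancel₀ hx'.ne'])
    (by rw [hscale, inv_mul_le_iff₀ hx']; linarith)
  rw [← smul_add, ← smul_sub, hscale, hscale, hscale] at key
  have key' : ‖x + h‖ + ‖x - h‖ - 2 * ‖x‖ ≤ ε * ‖h‖ := by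
    have := mul_le_mul_of_nonneg_left key hx'.le
    field_simp at this
    linarith
  have hsub : g (x - h) ≤ ‖x - h‖ :=
    (le_abs_self _).trans (by simpa using g.le_of_opNorm_le hg (x - h))
  rw [map_sub, hgx] at hsub
  linarith

/-- In a uniformly smooth space a supporting functional at `x ≠ 0` is the Fréchet derivative of
the norm at `x`. -/
theorem UniformlySmooth.hasFDerivAt_norm {E : Type*} [NormedAddCommGroup E] [NormedSpace ℝ E]
    (hE : UniformlySmooth E) {x : E} (hx : x ≠ 0) {g : E →L[ℝ] ℝ} (hg : ‖g‖ ≤ 1)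
    (hgx : g x = ‖x‖) : HasFDerivAt (fun z : E => ‖z‖) g x := by
  rw [hasFDerivAt_iff_isLittleO_nhds_zero, Asymptotics.isLittleO_iff]
  intro ε hε
  obtain ⟨δ, hδ, H⟩ := hE.exists_norm_add_le hε
  have hr : 0 < δ * ‖x‖ := mul_pos hδ (norm_pos_iff.2 hx)
  filter_upwards [Metric.closedBall_mem_nhds (0 : E) hr] with h hh
  have hupper := H x h g hg hgx (by simpa using hh)
  have hlower : g (x + h) ≤ ‖x + h‖ :=
    (le_abs_self _).trans (by simpa using g.le_of_opNorm_le hg (x + h))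
  rw [map_add, hgx] at hlower
  rw [Real.norm_eq_abs, abs_le]
  constructor <;> nlinarith [norm_nonneg h]

/-- In a uniformly smooth space `J_p x` is `‖x‖ ^ (p - 1)` times any supporting functional. -/
theorem UniformlySmooth.dualMapJ_eq {E : Type*} [NormedAddCommGroup E] [NormedSpace ℝ E]
    (hE : UniformlySmooth E) {p : ℝ} (hp : 2 ≤ p) {x : E} {g : E →L[ℝ] ℝ} (hg : ‖g‖ ≤ 1)
    (hgx : g x = ‖x‖) : dualMapJ p x = ‖x‖ ^ (p - 1) • g := by
  have hp0 : p ≠ 0 := by positivity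
  rcases eq_or_ne x 0 with rfl | hx
  · have hO : (fun z : E => ‖z‖ ^ p) =O[𝓝 0] fun z => ‖z - 0‖ ^ 2 := by
      refine Asymptotics.IsBigO.of_bound 1 ?_
      filter_upwards [Metric.closedBall_mem_nhds (0 : E) one_pos] with z hz
      have hz1 : ‖z‖ ≤ 1 := by simpa using hz
      rw [sub_zero, one_mul, Real.norm_of_nonneg (by positivity),
        Real.norm_of_nonneg (by positivity), ← Real.rpow_two]
      exact Real.rpow_le_rpow_of_exponent_ge' (norm_nonneg z) hz1 zero_le_two hp
    have hd : HasFDerivAt (fun z : E => ‖z‖ ^ p) (0 : E →L[ℝ] ℝ) 0 := hO.hasFDerivAt one_lt_two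
    rw [dualMapJ, hd.fderiv, norm_zero, Real.zero_rpow (by linarith), smul_zero, zero_smul]
  · have hd := (hE.hasFDerivAt_norm hx hg hgx).rpow_const (p := p) (Or.inl (norm_ne_zero_iff.2 hx))
    rw [dualMapJ, hd.fderiv, smul_smul, inv_mul_cancel_left₀ hp0]

/-- If the norm is approximated to first order at `x` by the supporting functional `f`, on the
ball of radius `r`, then every supporting functional at a nearby point `y` is close to `f`. -/
theorem norm_sub_le_of_norm_add_le {E : Type*} [NormedAddCommGroup E] [NormedSpace ℝ E]
    {x y : E} {f g : E →L[ℝ] ℝ} {ε r : ℝ} (hε : 0 ≤ ε) (hr : 0 < r) (hg : ‖g‖ ≤ 1)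
    (hgy : g y = ‖y‖) (H : ∀ h : E, ‖h‖ ≤ r → ‖x + h‖ ≤ ‖x‖ + f h + ε * ‖h‖) :
    ‖f - g‖ ≤ 2 * ‖x - y‖ / r + ε := by
  have hle : ∀ z : E, g z ≤ ‖z‖ := fun z =>
    (le_abs_self _).trans (by simpa using g.le_of_opNorm_le hg z)
  have hsmall : ∀ h : E, ‖h‖ ≤ r → g h - f h ≤ 2 * ‖x - y‖ + ε * ‖h‖ := fun h hh => by
    have h1 := hle (x + h)
    have h2 := hle (y - x)
    have h3 := norm_sub_norm_le x y
    rw [map_add] at h1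
    rw [map_sub, hgy, norm_sub_rev] at h2
    linarith [H h hh]
  have hbound : ∀ h : E, g h - f h ≤ (2 * ‖x - y‖ / r + ε) * ‖h‖ := fun h => by
    rcases eq_or_ne h 0 with rfl | hh
    · simp
    have hh' : 0 < ‖h‖ := norm_pos_iff.2 hh
    have hn : ‖(r / ‖h‖) • h‖ = r := by
      rw [norm_smul, Real.norm_of_nonneg (by positivity), div_mul_cancel₀ _ hh'.ne']
    have := hsmall ((r / ‖h‖) • h) hn.le
    rw [hn, map_smul, map_smul, smul_eq_mul, smul_eq_mul, ← mul_sub] at this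
    calc g h - f h = ‖h‖ / r * (r / ‖h‖ * (g h - f h)) := by field_simp
      _ ≤ ‖h‖ / r * (2 * ‖x - y‖ + ε * r) := by gcongr
      _ = (2 * ‖x - y‖ / r + ε) * ‖h‖ := by field_simp
  refine ContinuousLinearMap.opNorm_le_bound _ (by positivity) fun h => ?_
  have h1 := hbound h
  have h2 := hbound (-h)
  rw [map_neg, map_neg, norm_neg] at h2
  rw [sub_apply, Real.norm_eq_abs, abs_le]
  constructor <;> linarith

/-- In a uniformly smooth Banach space, for every `p ∈ [2,∞)` the mapping `J_p` is
locally uniformly continuous on the closed unit ball. -/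
theorem dualMapJ_locally_uniformly_continuous
    {E : Type*} [NormedAddCommGroup E] [NormedSpace ℝ E]
    (hE : UniformlySmooth E) (p : ℝ) (hp : 2 ≤ p) :
    ∀ ε > (0:ℝ), ∃ δ > (0:ℝ), ∀ x y : E, ‖x‖ ≤ 1 → ‖y‖ ≤ 1 → ‖x - y‖ ≤ δ →
      ‖dualMapJ p x - dualMapJ p y‖ ≤ ε := by
  intro ε hε
  obtain ⟨δ, hδ, H⟩ := hE.exists_norm_add_le (half_pos (half_pos hε))
  have hcont : ContinuousOn (fun t : ℝ => t ^ (p - 1)) (Icc 0 1) :=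
    (Real.continuous_rpow_const (by linarith)).continuousOn
  obtain ⟨η, hη, hη'⟩ := Metric.uniformContinuousOn_iff_le.1
    (isCompact_Icc.uniformContinuousOn_of_continuous hcont) (ε / 2) (half_pos hε)
  refine ⟨min η (ε * δ / 8), by positivity, fun x y hx hy hxy => ?_⟩
  obtain ⟨f, hf, hfx⟩ := exists_dual_vector'' ℝ x
  obtain ⟨g, hg, hgy⟩ := exists_dual_vector'' ℝ y
  rw [RCLike.ofReal_real_eq_id, id_eq] at hfx hgy
  rw [hE.dualMapJ_eq hp hf hfx, hE.dualMapJ_eq hp hg hgy]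
  have hfirst : ‖x‖ ^ (p - 1) * ‖f - g‖ ≤ ε / 2 := by
    rcases eq_or_ne x 0 with rfl | hx0
    · rw [norm_zero, Real.zero_rpow (by linarith), zero_mul]
      positivity
    have hx' : 0 < ‖x‖ := norm_pos_iff.2 hx0
    have hfg := norm_sub_le_of_norm_add_le (half_pos (half_pos hε)).le (mul_pos hδ hx') hg hgy
      fun h hh => H x h f hf hfx hh
    have hpow : ‖x‖ ^ (p - 1) ≤ ‖x‖ := by
      simpa using Real.rpow_le_rpow_of_exponent_ge hx' hx (by linarith : (1 : ℝ) ≤ p - 1)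
    calc ‖x‖ ^ (p - 1) * ‖f - g‖
        ≤ ‖x‖ * (2 * ‖x - y‖ / (δ * ‖x‖) + ε / 2 / 2) := by gcongr
      _ = 2 * ‖x - y‖ / δ + ‖x‖ * (ε / 2 / 2) := by field_simp
      _ ≤ 2 * (ε * δ / 8) / δ + 1 * (ε / 2 / 2) := by
          gcongr
          exact hxy.trans (min_le_right _ _)
      _ = ε / 2 := by field_simp; norm_num
  have hsecond : |‖x‖ ^ (p - 1) - ‖y‖ ^ (p - 1)| ≤ ε / 2 :=
    hη' ‖x‖ ⟨norm_nonneg x, hx⟩ ‖y‖ ⟨norm_nonneg y, hy⟩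
      ((abs_norm_sub_norm_le x y).trans (hxy.trans (min_le_left _ _)))
  calc ‖‖x‖ ^ (p - 1) • f - ‖y‖ ^ (p - 1) • g‖
      = ‖‖x‖ ^ (p - 1) • (f - g) + (‖x‖ ^ (p - 1) - ‖y‖ ^ (p - 1)) • g‖ := by
        congr 1
        module
    _ ≤ ‖x‖ ^ (p - 1) * ‖f - g‖ + |‖x‖ ^ (p - 1) - ‖y‖ ^ (p - 1)| * ‖g‖ := by
        refine (norm_add_le _ _).trans_eq ?_
        rw [norm_smul, norm_smul, Real.norm_of_nonneg (by positivity), Real.norm_eq_abs]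
    _ ≤ ε / 2 + ε / 2 * 1 := by gcongr
    _ = ε := by ring
end
end
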